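/- Let Ω ⊂ ℝ be an open bounded interval, let f satisfy hypothesis (F), and let η > 0, K > 0. Then there exists Γ₁(η,K) > 0 with the property that whenever v, v̂ ∈ L²(Ω) and Θ, Θ̂ ∈ W^{1,2}(Ω) satisfy Θ ≥ 0, Θ̂ ≥ 0 and ‖v̂‖_{L²(Ω)} + ‖Θ‖_{L¹(Ω)} ≤ K, one has both −∫_Ω {f'(Θ)Θ_x − f'(Θ̂)Θ̂_x}·(v−v̂) ≤ η∫_Ω (Θ_x−Θ̂_x)² + Γ₁(η,K)·{1 + ∫_Ω Θ_x²}·{∫_Ω (v−v̂)² + ∫_Ω (Θ−Θ̂)²} and ∫_Ω {f'(Θ)Θ_x v − f'(Θ̂)Θ̂_x v̂}·(Θ−Θ̂) + ∫_Ω {f(Θ)v − f(Θ̂)v̂}·(Θ_x−Θ̂_x) ≤ η∫_Ω (Θ_x−Θ̂_x)² + Γ₁(η,K)·{1 + ∫_Ω Θ_x²}·{∫_Ω (v−v̂)² + ∫_Ω (Θ−Θ̂)²}. -/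

import Mathlib

open MeasureTheory Filter Set Function

noncomputable section

/-- Integral over `Ω = (a,b)`. -/
def intOm (a b : ℝ) (g : ℝ → ℝ) : ℝ := ∫ x in Ioo a b, g x

/-- Double integral over `Ω × (0,T)`. -/
def intOmT (a b T : ℝ) (F : ℝ → ℝ → ℝ) : ℝ :=
  ∫ p in (Ioo a b) ×ˢ (Ioo 0 T), F p.1 p.2

/-- Squared `L²(Ω)` integral of `g`. -/
def sqOm (a b : ℝ) (g : ℝ → ℝ) : ℝ := ∫ x in Ioo a b, (g x) ^ 2

/-- `L²(Ω)` norm. -/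
def nrmL2 (a b : ℝ) (g : ℝ → ℝ) : ℝ := (∫ x in Ioo a b, (g x) ^ 2) ^ (1 / 2 : ℝ)

/-- `L¹(Ω)` norm. -/
def nrmL1 (a b : ℝ) (g : ℝ → ℝ) : ℝ := ∫ x in Ioo a b, |g x|

/-- Membership in `L²(Ω)`. -/
def MemL2 (a b : ℝ) (g : ℝ → ℝ) : Prop :=
  AEStronglyMeasurable g (volume.restrict (Ioo a b)) ∧
    IntegrableOn (fun x => (g x) ^ 2) (Ioo a b)

/-- Zero-trace weak derivative on `(a,b)`: `g ∈ W₀^{1,1}(a,b)` with weak derivative `g'`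
(integration by parts against all smooth test functions, with no boundary terms). -/
def WeakDerivZ (a b : ℝ) (g g' : ℝ → ℝ) : Prop :=
  ∀ ψ : ℝ → ℝ, ContDiff ℝ (⊤ : ℕ∞) ψ →
    ∫ x in Ioo a b, g x * deriv ψ x = - ∫ x in Ioo a b, g' x * ψ x

/-- Interior weak derivative on `(a,b)`: `g ∈ W^{1,1}(a,b)` with weak derivative `g'`. -/
def WeakDerivI (a b : ℝ) (g g' : ℝ → ℝ) : Prop :=
  ∀ ψ : ℝ → ℝ, ContDiff ℝ (⊤ : ℕ∞) ψ → tsupport ψ ⊆ Ioo a b →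
    ∫ x in Ioo a b, g x * deriv ψ x = - ∫ x in Ioo a b, g' x * ψ x

/-- Hypothesis (F) on the nonlinearity `f`, where `f'`, `f''` denote its first and second
derivatives on `[0,∞)`: `f ∈ C²([0,∞))`, `f(0)=0`, `f' > 0` on `[0,∞)`,
and `f' ∈ W^{1,∞}((0,∞))` (i.e. `f'` and `f''` are bounded). -/
structure HypF (f f' f'' : ℝ → ℝ) : Prop where
  hasDeriv₁ : ∀ x ∈ Ici (0 : ℝ), HasDerivWithinAt f (f' x) (Ici 0) x
  hasDeriv₂ : ∀ x ∈ Ici (0 : ℝ), HasDerivWithinAt f' (f'' x) (Ici 0) x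
  cont₂ : ContinuousOn f'' (Ici 0)
  zero : f 0 = 0
  pos : ∀ x ∈ Ici (0 : ℝ), 0 < f' x
  bdd : ∃ M : ℝ, ∀ x ∈ Ici (0 : ℝ), |f' x| ≤ M ∧ |f'' x| ≤ M

/-- Partial derivative in the first (spatial) variable. -/
def pdx (w : ℝ → ℝ → ℝ) : ℝ → ℝ → ℝ := fun x t => deriv (fun y => w y t) x

/-- Partial derivative in the second (time) variable. -/
def pdt (w : ℝ → ℝ → ℝ) : ℝ → ℝ → ℝ := fun x t => deriv (fun s => w x s) t

/-- Test functions in `C₀^∞(Ω × [0,T))`. -/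
structure TestU (a b T : ℝ) (φ : ℝ → ℝ → ℝ) : Prop where
  smooth : ContDiff ℝ (⊤ : ℕ∞) (uncurry φ)
  suppx : ∃ K : Set ℝ, IsCompact K ∧ K ⊆ Ioo a b ∧ ∀ x t, x ∉ K → φ x t = 0
  suppt : ∃ T' : ℝ, T' < T ∧ ∀ x t, T' ≤ t → φ x t = 0

/-- Test functions in `C^∞(Ω̄ × [0,T))`, compactly supported in time. -/
structure TestT (T : ℝ) (φ : ℝ → ℝ → ℝ) : Prop where
  smooth : ContDiff ℝ (⊤ : ℕ∞) (uncurry φ)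
  suppt : ∃ T' : ℝ, T' < T ∧ ∀ x t, T' ≤ t → φ x t = 0

/-- Test functions in `C₀^∞(Ω × (0,T))`. -/
structure TestInt (a b T : ℝ) (φ : ℝ → ℝ → ℝ) : Prop where
  smooth : ContDiff ℝ (⊤ : ℕ∞) (uncurry φ)
  suppx : ∃ K : Set ℝ, IsCompact K ∧ K ⊆ Ioo a b ∧ ∀ x t, x ∉ K → φ x t = 0
  supptime : ∃ K : Set ℝ, IsCompact K ∧ K ⊆ Ioo 0 T ∧ ∀ x t, t ∉ K → φ x t = 0

/-- Definition (W): weak solution of (P) on `Ω × (0,T)`.  Here `ut`, `ux`, `Θx` denote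
the weak derivatives of `u` (in time and space) and of `Θ` (in space). -/
structure IsWeakSol (a b T : ℝ) (f f' : ℝ → ℝ) (u0 u0t Θ0 : ℝ → ℝ)
    (u ut ux Θ Θx : ℝ → ℝ → ℝ) : Prop where
  u_sliceL1 : ∀ t ∈ Icc 0 T, IntegrableOn (fun x => u x t) (Ioo a b)
  u_contL1 : ∀ t₀ ∈ Icc 0 T,
    Tendsto (fun t => ∫ x in Ioo a b, |u x t - u x t₀|) (nhdsWithin t₀ (Icc 0 T)) (nhds 0)
  u_int : IntegrableOn (fun p : ℝ × ℝ => u p.1 p.2) ((Ioo a b) ×ˢ (Ioo 0 T))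
  ux_int : IntegrableOn (fun p : ℝ × ℝ => ux p.1 p.2) ((Ioo a b) ×ˢ (Ioo 0 T))
  u_W0 : ∀ᵐ t ∂volume.restrict (Ioo 0 T), WeakDerivZ a b (fun x => u x t) (fun x => ux x t)
  Θ_int : IntegrableOn (fun p : ℝ × ℝ => Θ p.1 p.2) ((Ioo a b) ×ˢ (Ioo 0 T))
  Θx_int : IntegrableOn (fun p : ℝ × ℝ => Θx p.1 p.2) ((Ioo a b) ×ˢ (Ioo 0 T))
  Θ_W : ∀ᵐ t ∂volume.restrict (Ioo 0 T), WeakDerivI a b (fun x => Θ x t) (fun x => Θx x t)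
  Θ_nonneg : ∀ᵐ p ∂volume.restrict ((Ioo a b) ×ˢ (Ioo 0 T)), 0 ≤ Θ p.1 p.2
  ut_weak : ∀ φ : ℝ → ℝ → ℝ, TestInt a b T φ →
    intOmT a b T (fun x t => u x t * pdt φ x t) = - intOmT a b T (fun x t => ut x t * φ x t)
  ut_int : IntegrableOn (fun p : ℝ × ℝ => ut p.1 p.2) ((Ioo a b) ×ˢ (Ioo 0 T))
  g1_int : IntegrableOn (fun p : ℝ × ℝ => f' (Θ p.1 p.2) * Θx p.1 p.2)
    ((Ioo a b) ×ˢ (Ioo 0 T))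
  g2_int : IntegrableOn (fun p : ℝ × ℝ => f' (Θ p.1 p.2) * Θx p.1 p.2 * ut p.1 p.2)
    ((Ioo a b) ×ˢ (Ioo 0 T))
  g3_int : IntegrableOn (fun p : ℝ × ℝ => f (Θ p.1 p.2) * ut p.1 p.2)
    ((Ioo a b) ×ˢ (Ioo 0 T))
  weak_u : ∀ φ : ℝ → ℝ → ℝ, TestU a b T φ →
    intOmT a b T (fun x t => u x t * pdt (pdt φ) x t)
        - intOm a b (fun x => u0t x * φ x 0) + intOm a b (fun x => u0 x * pdt φ x 0)
      = - intOmT a b T (fun x t => ux x t * pdx φ x t)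
        - intOmT a b T (fun x t => f' (Θ x t) * Θx x t * φ x t)
  weak_Θ : ∀ φ : ℝ → ℝ → ℝ, TestT T φ →
    - intOmT a b T (fun x t => Θ x t * pdt φ x t) - intOm a b (fun x => Θ0 x * φ x 0)
      = - intOmT a b T (fun x t => Θx x t * pdx φ x t)
        + intOmT a b T (fun x t => f' (Θ x t) * Θx x t * ut x t * φ x t)
        + intOmT a b T (fun x t => f (Θ x t) * ut x t * pdx φ x t)

/-- Continuity of `t ↦ w(·,t)` as a map `J → L²(Ω)` (with slices in `L²(Ω)`). -/
def ContL2 (a b : ℝ) (J : Set ℝ) (w : ℝ → ℝ → ℝ) : Prop :=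
  (∀ t ∈ J, MemL2 a b (fun x => w x t)) ∧
    ∀ t₀ ∈ J, Tendsto (fun t => ∫ x in Ioo a b, (w x t - w x t₀) ^ 2)
      (nhdsWithin t₀ J) (nhds 0)

/-- The regularity class (R_T):  `u ∈ C⁰([0,T];W₀^{1,2})`, `u_t ∈ C⁰([0,T];L²)`,
`Θ ∈ C⁰([0,T];L²) ∩ L²((0,T);W^{1,2})`. -/
structure RegT (a b T : ℝ) (u ut ux Θ Θx : ℝ → ℝ → ℝ) : Prop where
  u_cont : ContL2 a b (Icc 0 T) u
  ux_cont : ContL2 a b (Icc 0 T) ux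
  u_W0 : ∀ t ∈ Icc (0 : ℝ) T, WeakDerivZ a b (fun x => u x t) (fun x => ux x t)
  ut_cont : ContL2 a b (Icc 0 T) ut
  Θ_cont : ContL2 a b (Icc 0 T) Θ
  Θ_sq_int : IntegrableOn (fun p : ℝ × ℝ => (Θ p.1 p.2) ^ 2) ((Ioo a b) ×ˢ (Ioo 0 T))
  Θx_sq_int : IntegrableOn (fun p : ℝ × ℝ => (Θx p.1 p.2) ^ 2) ((Ioo a b) ×ˢ (Ioo 0 T))

/-- Data hypothesis (I), with `u0x` the weak derivative of `u0 ∈ W₀^{1,2}(Ω)`. -/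
structure DataI (a b : ℝ) (u0 u0x u0t Θ0 : ℝ → ℝ) : Prop where
  u0_L2 : MemL2 a b u0
  u0x_L2 : MemL2 a b u0x
  u0_W0 : WeakDerivZ a b u0 u0x
  u0t_L2 : MemL2 a b u0t
  Θ0_L2 : MemL2 a b Θ0
  Θ0_nonneg : ∀ᵐ x ∂volume.restrict (Ioo a b), 0 ≤ Θ0 x

/-- Smooth-data hypothesis (I∞). -/
structure SmoothData (a b : ℝ) (v0 u0 Θ0 : ℝ → ℝ) : Prop where
  v0_smooth : ContDiff ℝ (⊤ : ℕ∞) v0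
  v0_supp : ∃ K : Set ℝ, IsCompact K ∧ K ⊆ Ioo a b ∧ ∀ x, x ∉ K → v0 x = 0
  u0_smooth : ContDiff ℝ (⊤ : ℕ∞) u0
  u0_supp : ∃ K : Set ℝ, IsCompact K ∧ K ⊆ Ioo a b ∧ ∀ x, x ∉ K → u0 x = 0
  Θ0_smooth : ContDiff ℝ (⊤ : ℕ∞) Θ0
  Θ0_pos : ∀ x ∈ Icc a b, 0 < Θ0 x
  Θ0x_supp : ∃ K : Set ℝ, IsCompact K ∧ K ⊆ Ioo a b ∧ ∀ x, x ∉ K → deriv Θ0 x = 0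

/-- Classical solution of the regularized problem (P_ε), of class
`C^{4,1} × C^{2,1} × C^{2,1}(Ω̄ × [0,∞))`, with positive temperature. -/
structure IsClassicalSolEps (a b : ℝ) (f : ℝ → ℝ) (ε : ℝ) (v0 u0 Θ0 : ℝ → ℝ)
    (v u Θ : ℝ → ℝ → ℝ) : Prop where
  diffx_v : ∀ k < 4, ∀ x ∈ Icc a b, ∀ t ∈ Ici (0 : ℝ),
    DifferentiableAt ℝ (fun y => pdx^[k] v y t) x
  difft_v : ∀ x ∈ Icc a b, ∀ t ∈ Ici (0 : ℝ), DifferentiableAt ℝ (fun s => v x s) t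
  cont_v : ∀ k ≤ 4, ContinuousOn (uncurry (pdx^[k] v)) ((Icc a b) ×ˢ (Ici 0))
  contt_v : ContinuousOn (uncurry (pdt v)) ((Icc a b) ×ˢ (Ici 0))
  diffx_u : ∀ k < 2, ∀ x ∈ Icc a b, ∀ t ∈ Ici (0 : ℝ),
    DifferentiableAt ℝ (fun y => pdx^[k] u y t) x
  difft_u : ∀ x ∈ Icc a b, ∀ t ∈ Ici (0 : ℝ), DifferentiableAt ℝ (fun s => u x s) t
  cont_u : ∀ k ≤ 2, ContinuousOn (uncurry (pdx^[k] u)) ((Icc a b) ×ˢ (Ici 0))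
  contt_u : ContinuousOn (uncurry (pdt u)) ((Icc a b) ×ˢ (Ici 0))
  diffx_Θ : ∀ k < 2, ∀ x ∈ Icc a b, ∀ t ∈ Ici (0 : ℝ),
    DifferentiableAt ℝ (fun y => pdx^[k] Θ y t) x
  difft_Θ : ∀ x ∈ Icc a b, ∀ t ∈ Ici (0 : ℝ), DifferentiableAt ℝ (fun s => Θ x s) t
  cont_Θ : ∀ k ≤ 2, ContinuousOn (uncurry (pdx^[k] Θ)) ((Icc a b) ×ˢ (Ici 0))
  contt_Θ : ContinuousOn (uncurry (pdt Θ)) ((Icc a b) ×ˢ (Ici 0))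
  Θ_pos : ∀ x ∈ Icc a b, ∀ t ∈ Ici (0 : ℝ), 0 < Θ x t
  eq_v : ∀ x ∈ Ioo a b, ∀ t ∈ Ioi (0 : ℝ),
    pdt v x t = -ε * pdx^[4] v x t + pdx^[2] u x t - pdx (fun y s => f (Θ y s)) x t
  eq_u : ∀ x ∈ Ioo a b, ∀ t ∈ Ioi (0 : ℝ), pdt u x t = ε * pdx^[2] u x t + v x t
  eq_Θ : ∀ x ∈ Ioo a b, ∀ t ∈ Ioi (0 : ℝ),
    pdt Θ x t = pdx^[2] Θ x t - f (Θ x t) * pdx v x t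
  bc_v : ∀ t ∈ Ioi (0 : ℝ),
    v a t = 0 ∧ v b t = 0 ∧ pdx^[2] v a t = 0 ∧ pdx^[2] v b t = 0
  bc_u : ∀ t ∈ Ioi (0 : ℝ), u a t = 0 ∧ u b t = 0
  bc_Θ : ∀ t ∈ Ioi (0 : ℝ), pdx Θ a t = 0 ∧ pdx Θ b t = 0
  init : ∀ x ∈ Icc a b, v x 0 = v0 x ∧ u x 0 = u0 x ∧ Θ x 0 = Θ0 x

/-- Weak convergence in `L²_loc(Ω̄ × [0,∞))`. -/
def WkL2loc (a b : ℝ) (wj : ℕ → ℝ → ℝ → ℝ) (w : ℝ → ℝ → ℝ) : Prop :=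
  ∀ T > (0 : ℝ), ∀ ψ : ℝ → ℝ → ℝ,
    AEStronglyMeasurable (fun p : ℝ × ℝ => ψ p.1 p.2)
      (volume.restrict ((Icc a b) ×ˢ (Icc 0 T))) →
    IntegrableOn (fun p : ℝ × ℝ => (ψ p.1 p.2) ^ 2) ((Icc a b) ×ˢ (Icc 0 T)) →
    Tendsto (fun j => ∫ p in (Icc a b) ×ˢ (Icc 0 T), wj j p.1 p.2 * ψ p.1 p.2) atTop
      (nhds (∫ p in (Icc a b) ×ˢ (Icc 0 T), w p.1 p.2 * ψ p.1 p.2))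

/-- A smooth function of zero mean supported in `[c, d]` has a smooth primitive supported there. -/
theorem exists_primitive_tsupport_subset_Icc {χ : ℝ → ℝ} {c d : ℝ}
    (hχ : ContDiff ℝ (⊤ : ℕ∞) χ) (hsupp : support χ ⊆ Icc c d) (hint : ∫ x, χ x = 0) :
    ∃ ψ : ℝ → ℝ, ContDiff ℝ (⊤ : ℕ∞) ψ ∧ tsupport ψ ⊆ Icc c d ∧ deriv ψ = χ := by
  have hderiv : ∀ x, HasDerivAt (fun x => ∫ t in (c - 1)..x, χ t) (χ x) x := fun x =>
    hχ.continuous.integral_hasStrictDerivAt (c - 1) x |>.hasDerivAt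
  have hderiv' : deriv (fun x => ∫ t in (c - 1)..x, χ t) = χ := funext fun x => (hderiv x).deriv
  refine ⟨fun x => ∫ t in (c - 1)..x, χ t, ?_, ?_, hderiv'⟩
  · rw [contDiff_infty_iff_deriv, hderiv']
    exact ⟨fun x => (hderiv x).differentiableAt, hχ⟩
  · refine closure_minimal (fun x hx => ?_) isClosed_Icc
    by_contra hxn
    apply hx
    have hzero : ∀ t, t ∉ Icc c d → χ t = 0 := fun t ht => notMem_support.1 fun h => ht (hsupp h)
    rcases lt_or_ge x c with hxc | hcx
    · dsimp only
      rw [intervalIntegral.integral_congr (g := fun _ => (0 : ℝ)), intervalIntegral.integral_zero]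
      intro t ht
      refine hzero t fun h => ?_
      have := ht.2
      have h3 : max (c - 1) x < c := max_lt (by linarith) hxc
      linarith [h.1]
    · have hxd : d < x := not_le.1 fun h => hxn ⟨hcx, h⟩
      dsimp only
      rw [intervalIntegral.integral_eq_integral_of_support_subset, hint]
      exact fun t ht => ⟨by linarith [(hsupp ht).1], (hsupp ht).2.trans hxd.le⟩

/-- Du Bois-Reymond lemma: a function with vanishing weak derivative is constant. -/
theorem ae_eq_const_of_forall_integral_mul_deriv_eq_zero {a b : ℝ} (hab : a < b) {h : ℝ → ℝ}
    (hh : IntegrableOn h (Ioo a b))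
    (hw : ∀ ψ : ℝ → ℝ, ContDiff ℝ (⊤ : ℕ∞) ψ → tsupport ψ ⊆ Ioo a b →
      ∫ x in Ioo a b, h x * deriv ψ x = 0) :
    ∃ c : ℝ, ∀ᵐ x ∂volume.restrict (Ioo a b), h x = c := by
  let B : ContDiffBump ((a + b) / 2) :=
    ⟨(b - a) / 8, (b - a) / 4, by linarith, by linarith⟩
  set ρ : ℝ → ℝ := B.normed volume with hρdef
  have hρ : ContDiff ℝ (⊤ : ℕ∞) ρ := B.contDiff_normed
  have hρsupp : tsupport ρ = Icc ((a + b) / 2 - (b - a) / 4) ((a + b) / 2 + (b - a) / 4) := by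
    rw [hρdef, B.tsupport_normed_eq, Real.closedBall_eq_Icc]
  have hρint : ∫ x, ρ x = 1 := B.integral_normed
  have hρc : HasCompactSupport ρ := B.hasCompactSupport_normed
  have hmul : ∀ φ : ℝ → ℝ, Continuous φ → HasCompactSupport φ →
      IntegrableOn (fun x => h x * φ x) (Ioo a b) := fun φ hφ hφc => by
    obtain ⟨C, hC⟩ := hφ.bounded_above_of_compact_support hφc
    exact hh.mul_bdd (c := C) hφ.aestronglyMeasurable (Eventually.of_forall hC)
  set c₀ := ∫ x in Ioo a b, h x * ρ x
  refine ⟨c₀, ?_⟩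
  rw [ae_restrict_iff' measurableSet_Ioo]
  have key := isOpen_Ioo.ae_eq_zero_of_integral_contDiff_smul_eq_zero (μ := volume)
    (U := Ioo a b) (f := fun x => h x - c₀)
    ((hh.sub (integrableOn_const (by simp))).locallyIntegrableOn) ?_
  · filter_upwards [key] with x hx hxm using sub_eq_zero.1 (hx hxm)
  intro φ hφ hφc hφs
  set J := ∫ x, φ x with hJ
  set S := tsupport φ ∪ tsupport ρ
  have hSc : IsCompact S := hφc.isCompact.union hρc.isCompact
  have hSs : S ⊆ Ioo a b := union_subset hφs (by
    rw [hρsupp]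
    exact fun x hx => ⟨by linarith [hx.1], by linarith [hx.2]⟩)
  have hSn : S.Nonempty := by
    refine Nonempty.inr ?_
    rw [hρsupp]
    exact nonempty_Icc.2 (by linarith)
  have hsupp : support (fun x => φ x - J * ρ x) ⊆ Icc (sInf S) (sSup S) := by
    intro x hx
    have hxS : x ∈ S := by
      by_contra hn
      have h1 : φ x = 0 := image_eq_zero_of_notMem_tsupport fun h => hn (Or.inl h)
      have h2 : ρ x = 0 := image_eq_zero_of_notMem_tsupport fun h => hn (Or.inr h)
      exact hx (by simp [h1, h2])
    exact ⟨csInf_le hSc.bddBelow hxS, le_csSup hSc.bddAbove hxS⟩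
  have hIcc : Icc (sInf S) (sSup S) ⊆ Ioo a b := fun x hx =>
    ⟨(hSs (hSc.sInf_mem hSn)).1.trans_le hx.1, hx.2.trans_lt (hSs (hSc.sSup_mem hSn)).2⟩
  have hφi : Integrable φ := hφ.continuous.integrable_of_hasCompactSupport hφc
  have hρi : Integrable ρ := hρ.continuous.integrable_of_hasCompactSupport hρc
  obtain ⟨ψ, hψ, hψs, hψd⟩ := exists_primitive_tsupport_subset_Icc
    (χ := fun x => φ x - J * ρ x) (hφ.sub (contDiff_const.mul hρ)) hsupp (by
      rw [integral_sub hφi (hρi.const_mul J), integral_const_mul, hρint, ← hJ]; ring)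
  have h0 := hw ψ hψ (hψs.trans hIcc)
  rw [hψd] at h0
  have h1 : ∫ x in Ioo a b, h x * φ x = J * c₀ := by
    have : ∫ x in Ioo a b, h x * (φ x - J * ρ x)
        = (∫ x in Ioo a b, h x * φ x) - J * c₀ := by
      rw [← integral_const_mul, ← integral_sub (hmul φ hφ.continuous hφc)
        ((hmul ρ hρ.continuous hρc).const_mul J)]
      congr 1; ext x; ring
    linarith
  have h2 : ∫ x in Ioo a b, φ x = J := setIntegral_eq_integral_of_forall_compl_eq_zero
    fun x hx => image_eq_zero_of_notMem_tsupport fun h => hx (hφs h)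
  rw [← setIntegral_eq_integral_of_forall_compl_eq_zero (s := Ioo a b)]
  · have : ∀ x, φ x • (h x - c₀) = h x * φ x - c₀ * φ x := fun x => by simp only [smul_eq_mul]; ring
    simp_rw [this]
    rw [integral_sub (hmul φ hφ.continuous hφc) (hφi.integrableOn.const_mul c₀),
      integral_const_mul, h1, h2]
    ring
  · intro x hx
    rw [image_eq_zero_of_notMem_tsupport fun h => hx (hφs h), zero_smul]

/-- A weakly differentiable function has an absolutely continuous representative. -/
theorem WeakDerivI.exists_absolutelyContinuous {a b : ℝ} (hab : a < b) {g g' : ℝ → ℝ}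
    (hw : WeakDerivI a b g g') (hg : IntegrableOn g (Ioo a b)) (hg' : IntegrableOn g' (Ioo a b)) :
    ∃ G : ℝ → ℝ, AbsolutelyContinuousOnInterval G a b ∧
      (∀ᵐ x ∂volume.restrict (Ioo a b), G x = g x) ∧
      ∀ᵐ x ∂volume.restrict (Ioo a b), HasDerivAt G (g' x) x := by
  have hii : IntervalIntegrable g' volume a b :=
    (intervalIntegrable_iff_integrableOn_Ioo_of_le hab.le).2 hg'
  set P : ℝ → ℝ := fun x => ∫ t in a..x, g' t
  have hP : AbsolutelyContinuousOnInterval P a b :=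
    hii.absolutelyContinuousOnInterval_intervalIntegral left_mem_uIcc
  have hPd : ∀ᵐ x ∂volume.restrict (Ioo a b), HasDerivAt P (g' x) x := by
    rw [ae_restrict_iff' measurableSet_Ioo]
    filter_upwards [hii.ae_hasDerivAt_integral] with x hx hxm
    exact hx (by rw [uIcc_of_le hab.le]; exact Ioo_subset_Icc_self hxm) a left_mem_uIcc
  have hPi : IntegrableOn P (Ioo a b) := by
    have := hP.continuousOn
    rw [uIcc_of_le hab.le] at this
    exact (this.integrableOn_compact isCompact_Icc).mono_set Ioo_subset_Icc_self
  have hIoo : ∀ F : ℝ → ℝ, ∫ x in a..b, F x = ∫ x in Ioo a b, F x := fun F => by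
    rw [intervalIntegral.integral_of_le hab.le, integral_Ioc_eq_integral_Ioo]
  obtain ⟨c, hc⟩ := ae_eq_const_of_forall_integral_mul_deriv_eq_zero hab (hg.sub hPi) (by
    intro ψ hψ hψs
    have hψac : AbsolutelyContinuousOnInterval ψ a b :=
      (hψ.of_le (by exact_mod_cast le_top)).contDiffOn.absolutelyContinuousOnInterval
    have hparts := hP.integral_mul_deriv_eq_deriv_mul hψac
    have hψa : ψ a = 0 := image_eq_zero_of_notMem_tsupport fun h => (hψs h).1.false
    have hψb : ψ b = 0 := image_eq_zero_of_notMem_tsupport fun h => (hψs h).2.false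
    rw [hψa, hψb, hIoo, hIoo] at hparts
    have hcongr : ∫ x in Ioo a b, deriv P x * ψ x = ∫ x in Ioo a b, g' x * ψ x := by
      refine integral_congr_ae ?_
      filter_upwards [hPd] with x hx
      rw [hx.deriv]
    have hdc : Continuous (deriv ψ) := hψ.continuous_deriv (by simp)
    obtain ⟨C, hC⟩ := isCompact_Icc.exists_bound_of_continuousOn (s := Icc a b) hdc.continuousOn
    have hmul : ∀ F : ℝ → ℝ, IntegrableOn F (Ioo a b) →
        IntegrableOn (fun x => F x * deriv ψ x) (Ioo a b) := fun F hF =>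
      Integrable.mul_bdd (c := C) hF hdc.aestronglyMeasurable <| by
        filter_upwards [ae_restrict_mem measurableSet_Ioo] with x hx
        exact hC x (Ioo_subset_Icc_self hx)
    simp only [Pi.sub_apply, sub_mul]
    rw [integral_sub (hmul g hg) (hmul P hPi), hw ψ hψ hψs, hparts, hcongr]
    ring)
  refine ⟨fun x => P x + c, ?_, ?_, ?_⟩
  · have hconst : AbsolutelyContinuousOnInterval (fun _ : ℝ => c) a b :=
      (contDiff_const (n := 1)).contDiffOn.absolutelyContinuousOnInterval
    exact hP.add hconst
  · filter_upwards [hc] with x hx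
    simp only [Pi.sub_apply] at hx
    linarith
  · filter_upwards [hPd] with x hx using hx.add_const c

/-- The elementary one-dimensional Sobolev inequality `W^{1,1} ⊆ L^∞`. -/
theorem AbsolutelyContinuousOnInterval.abs_le_integral_add {a b : ℝ} (hab : a < b) {H h : ℝ → ℝ}
    (hH : AbsolutelyContinuousOnInterval H a b)
    (hd : ∀ᵐ x ∂volume.restrict (Ioo a b), HasDerivAt H (h x) x) {x : ℝ} (hx : x ∈ Icc a b) :
    |H x| ≤ (∫ y in Ioo a b, |H y|) / (b - a) + ∫ y in Ioo a b, |h y| := by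
  set D := ∫ y in Ioo a b, |h y|
  have hder : D = ∫ y in Ioc a b, ‖deriv H y‖ := by
    rw [integral_Ioc_eq_integral_Ioo]
    refine integral_congr_ae ?_
    filter_upwards [hd] with y hy
    rw [hy.deriv, Real.norm_eq_abs]
  have hii := (intervalIntegrable_iff_integrableOn_Ioc_of_le hab.le).1 hH.intervalIntegrable_deriv
  have hdiff : ∀ y ∈ Ioo a b, |H x| ≤ |H y| + D := fun y hy => by
    have hy' : y ∈ Icc a b := Ioo_subset_Icc_self hy
    have hsub : uIcc y x ⊆ uIcc a b := by
      rw [uIcc_of_le hab.le]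
      exact uIcc_subset_Icc hy' hx
    have h1 := (hH.mono hsub).integral_deriv_eq_sub
    have h2 : |H x - H y| ≤ D := by
      rw [← h1, ← Real.norm_eq_abs, hder]
      refine intervalIntegral.norm_integral_le_integral_norm_uIoc.trans ?_
      refine setIntegral_mono_set hii.norm (Eventually.of_forall fun _ => norm_nonneg _) ?_
      have hsub' : uIoc y x ⊆ Ioc a b := Ioc_subset_Ioc (le_min hy'.1 hx.1) (max_le hy'.2 hx.2)
      exact hsub'.eventuallyLE
    have h3 : |H x| ≤ |H y| + |H x - H y| := by
      simpa using abs_add_le (H y) (H x - H y)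
    linarith
  have hHi : IntegrableOn (fun y => |H y|) (Ioo a b) := by
    have := hH.continuousOn.abs
    rw [uIcc_of_le hab.le] at this
    exact (this.integrableOn_compact isCompact_Icc).mono_set Ioo_subset_Icc_self
  have hconst : ∀ c : ℝ, IntegrableOn (fun _ => c) (Ioo a b) := fun c =>
    integrableOn_const (by simp)
  have hmono := setIntegral_mono_on (hconst |H x|) (hHi.add (hconst D)) measurableSet_Ioo hdiff
  have hL : 0 < b - a := sub_pos.2 hab
  simp only [Pi.add_apply] at hmono
  rw [integral_add hHi (hconst D), setIntegral_const, setIntegral_const, smul_eq_mul, smul_eq_mul,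
    Real.volume_real_Ioo_of_le hab.le] at hmono
  have : |H x| - D ≤ (∫ y in Ioo a b, |H y|) / (b - a) := by
    rw [le_div_iff₀ hL]
    linarith
  linarith

namespace MemL2

variable {a b : ℝ} {g h : ℝ → ℝ}

theorem memLp (hg : MemL2 a b g) : MemLp g 2 (volume.restrict (Ioo a b)) :=
  (memLp_two_iff_integrable_sq hg.1).2 hg.2

theorem abs (hg : MemL2 a b g) : MemL2 a b fun x => |g x| :=
  ⟨hg.1.norm, by simpa only [sq_abs] using hg.2⟩

theorem integrableOn (hg : MemL2 a b g) : IntegrableOn g (Ioo a b) :=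
  hg.memLp.integrable (by norm_num)

theorem sub (hg : MemL2 a b g) (hh : MemL2 a b h) : MemL2 a b fun x => g x - h x :=
  ⟨hg.1.sub hh.1, (hg.memLp.sub hh.memLp).integrable_sq⟩

theorem integrableOn_mul (hg : MemL2 a b g) (hh : MemL2 a b h) :
    IntegrableOn (fun x => g x * h x) (Ioo a b) :=
  hg.memLp.integrable_mul hh.memLp

theorem integral_abs_mul_abs_le (hg : MemL2 a b g) (hh : MemL2 a b h) :
    ∫ x in Ioo a b, |g x| * |h x| ≤
      √(∫ x in Ioo a b, g x ^ 2) * √(∫ x in Ioo a b, h x ^ 2) := by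
  have := integral_mul_norm_le_Lp_mul_Lq (μ := volume.restrict (Ioo a b)) (f := g) (g := h)
    Real.HolderConjugate.two_two (by simpa using hg.memLp) (by simpa using hh.memLp)
  simpa [Real.sqrt_eq_rpow] using this

end MemL2

theorem WeakDerivI.sub {a b : ℝ} {g g' h h' : ℝ → ℝ}
    (hg : MemL2 a b g) (hg' : MemL2 a b g') (hh : MemL2 a b h) (hh' : MemL2 a b h')
    (hw : WeakDerivI a b g g') (hw' : WeakDerivI a b h h') :
    WeakDerivI a b (fun x => g x - h x) fun x => g' x - h' x := by
  intro ψ hψ hψs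
  have hmul : ∀ {F φ : ℝ → ℝ}, MemL2 a b F → Continuous φ →
      IntegrableOn (fun x => F x * φ x) (Ioo a b) := fun {F φ} hF hφ => by
    obtain ⟨C, hC⟩ := isCompact_Icc.exists_bound_of_continuousOn (s := Icc a b) hφ.continuousOn
    refine hF.integrableOn.mul_bdd (c := C) hφ.aestronglyMeasurable ?_
    filter_upwards [ae_restrict_mem measurableSet_Ioo] with x hx
    exact hC x (Ioo_subset_Icc_self hx)
  have hdc : Continuous (deriv ψ) := hψ.continuous_deriv (by simp)
  simp only [sub_mul]
  rw [integral_sub (hmul hg hdc) (hmul hh hdc),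
    integral_sub (hmul hg' hψ.continuous) (hmul hh' hψ.continuous), hw ψ hψ hψs, hw' ψ hψ hψs]
  ring

/-- One-dimensional Gagliardo-Nirenberg inequality in `W^{1,2}(a, b)`. -/
theorem WeakDerivI.ae_sq_le {a b : ℝ} (hab : a < b) {g g' : ℝ → ℝ} (hw : WeakDerivI a b g g')
    (hg : MemL2 a b g) (hg' : MemL2 a b g') :
    ∀ᵐ x ∂volume.restrict (Ioo a b), g x ^ 2 ≤ (∫ y in Ioo a b, g y ^ 2) / (b - a) +
      2 * (√(∫ y in Ioo a b, g y ^ 2) * √(∫ y in Ioo a b, g' y ^ 2)) := by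
  obtain ⟨G, hG, hGg, hGd⟩ := hw.exists_absolutelyContinuous hab hg.integrableOn hg'.integrableOn
  have hd : ∀ᵐ x ∂volume.restrict (Ioo a b),
      HasDerivAt (fun x => G x * G x) (2 * (g x * g' x)) x := by
    filter_upwards [hGg, hGd] with x hx hxd
    exact (hxd.fun_mul hxd).congr_deriv (by rw [hx]; ring)
  filter_upwards [hGg, ae_restrict_mem measurableSet_Ioo] with x hx hxm
  have hle := AbsolutelyContinuousOnInterval.abs_le_integral_add hab (hG.fun_mul hG) hd
    (Ioo_subset_Icc_self hxm)
  have h1 : ∫ y in Ioo a b, |G y * G y| = ∫ y in Ioo a b, g y ^ 2 := by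
    refine integral_congr_ae ?_
    filter_upwards [hGg] with y hy
    rw [hy, abs_mul_self, sq]
  have h2 : ∫ y in Ioo a b, |2 * (g y * g' y)| ≤
      2 * (√(∫ y in Ioo a b, g y ^ 2) * √(∫ y in Ioo a b, g' y ^ 2)) := by
    simp_rw [abs_mul, abs_two]
    rw [integral_const_mul]
    gcongr
    exact hg.integral_abs_mul_abs_le hg'
  rw [h1, hx, abs_mul_self, ← sq] at hle
  linarith

/-- The embedding `W^{1,2}(a, b) ⊆ L^∞`, with the lower-order term measured in `L¹`. -/
theorem WeakDerivI.ae_abs_le {a b : ℝ} (hab : a < b) {g g' : ℝ → ℝ} (hw : WeakDerivI a b g g')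
    (hg : MemL2 a b g) (hg' : MemL2 a b g') :
    ∀ᵐ x ∂volume.restrict (Ioo a b), |g x| ≤ (∫ y in Ioo a b, |g y|) / (b - a) +
      √(b - a) * √(∫ y in Ioo a b, g' y ^ 2) := by
  obtain ⟨G, hG, hGg, hGd⟩ := hw.exists_absolutelyContinuous hab hg.integrableOn hg'.integrableOn
  filter_upwards [hGg, ae_restrict_mem measurableSet_Ioo] with x hx hxm
  have hle := hG.abs_le_integral_add hab hGd (Ioo_subset_Icc_self hxm)
  have h1 : ∫ y in Ioo a b, |G y| = ∫ y in Ioo a b, |g y| := by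
    refine integral_congr_ae ?_
    filter_upwards [hGg] with y hy
    rw [hy]
  have hone : MemL2 a b fun _ => (1 : ℝ) :=
    ⟨aestronglyMeasurable_const, integrableOn_const (by simp)⟩
  have h2 := hone.integral_abs_mul_abs_le hg'
  simp only [abs_one, one_mul, one_pow, setIntegral_const, smul_eq_mul, mul_one,
    Real.volume_real_Ioo_of_le hab.le] at h2
  rw [h1, hx] at hle
  linarith

theorem HypF.exists_bounds {f f' f'' : ℝ → ℝ} (hf : HypF f f' f'') :
    ∃ M > (0 : ℝ), (∀ s, 0 ≤ s → |f' s| ≤ M) ∧ (∀ s, 0 ≤ s → |f s| ≤ M * |s|) ∧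
      (∀ s t, 0 ≤ s → 0 ≤ t → |f s - f t| ≤ M * |s - t|) ∧
      ∀ s t, 0 ≤ s → 0 ≤ t → |f' s - f' t| ≤ M * |s - t| := by
  obtain ⟨M, hM⟩ := hf.bdd
  have hlip : ∀ s t, 0 ≤ s → 0 ≤ t → |f s - f t| ≤ M * |s - t| := fun s t hs ht =>
    (convex_Ici (0 : ℝ)).norm_image_sub_le_of_norm_hasDerivWithin_le hf.hasDeriv₁
      (fun x hx => (hM x hx).1) ht hs
  refine ⟨M, (hf.pos 0 self_mem_Ici).trans_le ((le_abs_self _).trans (hM 0 self_mem_Ici).1),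
    fun s hs => (hM s hs).1, fun s hs => ?_, hlip, fun s t hs ht => ?_⟩
  · simpa [hf.zero] using hlip s 0 hs le_rfl
  · exact (convex_Ici (0 : ℝ)).norm_image_sub_le_of_norm_hasDerivWithin_le hf.hasDeriv₂
      (fun x hx => (hM x hx).2) ht hs

theorem abs_integral_le_of_ae_abs_le {μ : Measure ℝ} {F G : ℝ → ℝ} (hG : Integrable G μ)
    (h : ∀ᵐ x ∂μ, |F x| ≤ G x) : |∫ x, F x ∂μ| ≤ ∫ x, G x ∂μ :=
  (Real.norm_eq_abs _).symm.trans_le (norm_integral_le_of_norm_le hG h)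

theorem mul_le_mul_sq_add_sq_div {ε : ℝ} (hε : 0 < ε) (X Y : ℝ) :
    2 * (X * Y) ≤ ε * X ^ 2 + Y ^ 2 / ε := by
  have h : 0 ≤ (ε * X - Y) ^ 2 / ε := by positivity
  have : (ε * X - Y) ^ 2 / ε = ε * X ^ 2 + Y ^ 2 / ε - 2 * (X * Y) := by
    field_simp
    ring
  linarith

/-- Absorption of all products arising in the difference estimates; `A`, `B`, `Z`, `T` stand for
the `L²` norms of `Θ_x - Θ̂_x`, `Θ - Θ̂`, `v - v̂`, `Θ_x`, and `S` bounds `|Θ - Θ̂|`. -/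
theorem exists_absorption_const {L ε : ℝ} (hL : 0 < L) (hε : 0 < ε) :
    ∃ C > (0 : ℝ), ∀ A B Z T S : ℝ, 0 ≤ A → 0 ≤ B → 0 ≤ Z → 0 ≤ T → 0 ≤ S →
      S ^ 2 = B ^ 2 / L + 2 * (B * A) →
      A * Z + T * (A * Z) + S * (T * Z) + S * A + S ^ 2 * T ≤
        ε * A ^ 2 + C * (1 + T ^ 2) * (Z ^ 2 + B ^ 2) := by
  set δ := ε / 6 with hδ
  have hδ0 : 0 < δ := by positivity
  refine ⟨2 / δ + 1 + 2 / L + 2 / δ + 1 / (L * δ) + 1 / δ ^ 3, by positivity, ?_⟩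
  intro A B Z T S hA hB hZ hT hS hS2
  have hAZ := mul_le_mul_sq_add_sq_div hδ0 A Z
  have hATZ := mul_le_mul_sq_add_sq_div hδ0 A (T * Z)
  have hSTZ : S * (T * Z) ≤ S ^ 2 + T ^ 2 * Z ^ 2 := by
    nlinarith [sq_nonneg (S - T * Z), sq_nonneg S, sq_nonneg (T * Z)]
  have hS2le : S ^ 2 ≤ δ * A ^ 2 + (1 / L + 1 / δ) * B ^ 2 := by
    have := mul_le_mul_sq_add_sq_div hδ0 A B
    rw [hS2]
    calc B ^ 2 / L + 2 * (B * A) ≤ B ^ 2 / L + (δ * A ^ 2 + B ^ 2 / δ) := by linarith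
      _ = _ := by ring
  have hSA := mul_le_mul_sq_add_sq_div hδ0 A S
  have hS2div : S ^ 2 / δ ≤ δ * A ^ 2 + (1 / (L * δ) + 1 / δ ^ 3) * B ^ 2 := by
    have := mul_le_mul_sq_add_sq_div (pow_pos hδ0 2) A B
    rw [hS2]
    calc (B ^ 2 / L + 2 * (B * A)) / δ ≤ (B ^ 2 / L + (δ ^ 2 * A ^ 2 + B ^ 2 / δ ^ 2)) / δ := by
          gcongr
          linarith
      _ = _ := by
          field_simp
          ring
  have hS2T : S ^ 2 * T ≤ (1 / L) * ((1 + T ^ 2) * B ^ 2) + δ * A ^ 2 + (1 / δ) * (T ^ 2 * B ^ 2) := by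
    have := mul_le_mul_sq_add_sq_div hδ0 A (T * B)
    have hT1 : T ≤ 1 + T ^ 2 := by nlinarith [sq_nonneg (T - 1)]
    have h1 : B ^ 2 / L * T ≤ B ^ 2 / L * (1 + T ^ 2) := by gcongr
    rw [hS2]
    calc (B ^ 2 / L + 2 * (B * A)) * T = B ^ 2 / L * T + 2 * (A * (T * B)) := by ring
      _ ≤ B ^ 2 / L * (1 + T ^ 2) + (δ * A ^ 2 + (T * B) ^ 2 / δ) := by linarith
      _ = _ := by ring
  set Q := (1 + T ^ 2) * (Z ^ 2 + B ^ 2) with hQ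
  have hQ1 : Z ^ 2 ≤ Q := by
    nlinarith [sq_nonneg B, mul_nonneg (sq_nonneg T) (sq_nonneg Z),
      mul_nonneg (sq_nonneg T) (sq_nonneg B)]
  have hQ2 : B ^ 2 ≤ Q := by
    nlinarith [sq_nonneg Z, mul_nonneg (sq_nonneg T) (sq_nonneg Z),
      mul_nonneg (sq_nonneg T) (sq_nonneg B)]
  have hQ3 : T ^ 2 * Z ^ 2 ≤ Q := by
    nlinarith [sq_nonneg Z, sq_nonneg B, mul_nonneg (sq_nonneg T) (sq_nonneg B)]
  have hQ4 : T ^ 2 * B ^ 2 ≤ Q := by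
    nlinarith [sq_nonneg Z, sq_nonneg B, mul_nonneg (sq_nonneg T) (sq_nonneg Z)]
  have hQ5 : (1 + T ^ 2) * B ^ 2 ≤ Q := by
    nlinarith [sq_nonneg Z, mul_nonneg (sq_nonneg T) (sq_nonneg Z)]
  have h1 : Z ^ 2 / δ ≤ 1 / δ * Q := by rw [div_eq_mul_one_div, mul_comm]; gcongr
  have h2 : (T * Z) ^ 2 / δ ≤ 1 / δ * Q := by
    rw [div_eq_mul_one_div, mul_comm, mul_pow]; gcongr
  have h3 : (1 / L + 1 / δ) * B ^ 2 ≤ (1 / L + 1 / δ) * Q := by gcongr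
  have h4 : (1 / (L * δ) + 1 / δ ^ 3) * B ^ 2 ≤ (1 / (L * δ) + 1 / δ ^ 3) * Q := by gcongr
  have h5 : 1 / L * ((1 + T ^ 2) * B ^ 2) ≤ 1 / L * Q := by gcongr
  have h6 : 1 / δ * (T ^ 2 * B ^ 2) ≤ 1 / δ * Q := by gcongr
  have hAZ0 : 0 ≤ A * Z := by positivity
  have hATZ0 : 0 ≤ A * (T * Z) := by positivity
  have hSA0 : 0 ≤ A * S := by positivity
  have hεδ : ε = 6 * δ := by rw [hδ]; ring
  rw [mul_assoc _ (1 + T ^ 2), ← hQ, hεδ]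
  have e1 : T * (A * Z) = A * (T * Z) := by ring
  have e2 : (2 / δ + 1 + 2 / L + 2 / δ + 1 / (L * δ) + 1 / δ ^ 3) * Q =
      1 / δ * Q + 1 / δ * Q + Q + (1 / L + 1 / δ) * Q + (1 / (L * δ) + 1 / δ ^ 3) * Q
        + 1 / L * Q + 1 / δ * Q := by ring
  linarith

set_option maxHeartbeats 1000000 in
/-- Lemma 2.1: the two difference estimates. -/
theorem statement2
    (a b : ℝ) (hab : a < b)
    (f f' f'' : ℝ → ℝ) (hf : HypF f f' f'')
    (η K : ℝ) (hη : 0 < η) (hK : 0 < K) :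
    ∃ Γ > (0 : ℝ), ∀ v vh Θ Θx Θh Θhx : ℝ → ℝ,
      MemL2 a b v → MemL2 a b vh →
      MemL2 a b Θ → MemL2 a b Θx → WeakDerivI a b Θ Θx →
      MemL2 a b Θh → MemL2 a b Θhx → WeakDerivI a b Θh Θhx →
      (∀ᵐ x ∂volume.restrict (Ioo a b), 0 ≤ Θ x) →
      (∀ᵐ x ∂volume.restrict (Ioo a b), 0 ≤ Θh x) →
      nrmL2 a b vh + nrmL1 a b Θ ≤ K →
      (-(∫ x in Ioo a b, (f' (Θ x) * Θx x - f' (Θh x) * Θhx x) * (v x - vh x))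
          ≤ η * (∫ x in Ioo a b, (Θx x - Θhx x) ^ 2)
            + Γ * (1 + ∫ x in Ioo a b, (Θx x) ^ 2) *
              ((∫ x in Ioo a b, (v x - vh x) ^ 2) + ∫ x in Ioo a b, (Θ x - Θh x) ^ 2)) ∧
      ((∫ x in Ioo a b, (f' (Θ x) * Θx x * v x - f' (Θh x) * Θhx x * vh x) * (Θ x - Θh x))
          + (∫ x in Ioo a b, (f (Θ x) * v x - f (Θh x) * vh x) * (Θx x - Θhx x))
          ≤ η * (∫ x in Ioo a b, (Θx x - Θhx x) ^ 2)
            + Γ * (1 + ∫ x in Ioo a b, (Θx x) ^ 2) *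
              ((∫ x in Ioo a b, (v x - vh x) ^ 2) + ∫ x in Ioo a b, (Θ x - Θh x) ^ 2)) := by
  obtain ⟨M, hM0, hf'M, hfM, hfLip, hf'Lip⟩ := hf.exists_bounds
  have hL : 0 < b - a := sub_pos.2 hab
  set L := b - a with hLdef
  set N := M + 3 * (M * K) + M * (K / L) + M * √L with hN
  have hN0 : 0 < N := by positivity
  obtain ⟨C, hC0, hC⟩ := exists_absorption_const hL (div_pos hη hN0)
  refine ⟨N * C, by positivity, ?_⟩
  intro v vh Θ Θx Θh Θhx hv hvh hΘ hΘx hΘw hΘh hΘhx hΘhw hΘ0 hΘh0 hbound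
  set z : ℝ → ℝ := fun x => v x - vh x with hz
  set w : ℝ → ℝ := fun x => Θ x - Θh x with hw
  set wx : ℝ → ℝ := fun x => Θx x - Θhx x with hwx
  have hzm : MemL2 a b z := hv.sub hvh
  have hwm : MemL2 a b w := hΘ.sub hΘh
  have hwxm : MemL2 a b wx := hΘx.sub hΘhx
  have hGN := (WeakDerivI.sub hΘ hΘx hΘh hΘhx hΘw hΘhw).ae_sq_le hab hwm hwxm
  have hSob := hΘw.ae_abs_le hab hΘ hΘx
  set A := √(∫ x in Ioo a b, wx x ^ 2) with hA
  set B := √(∫ x in Ioo a b, w x ^ 2) with hB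
  set Z := √(∫ x in Ioo a b, z x ^ 2) with hZ
  set T := √(∫ x in Ioo a b, Θx x ^ 2) with hT
  have hsq : ∀ g : ℝ → ℝ, √(∫ x in Ioo a b, g x ^ 2) ^ 2 = ∫ x in Ioo a b, g x ^ 2 := fun g =>
    Real.sq_sqrt (integral_nonneg fun x => sq_nonneg _)
  have hA2 : ∫ x in Ioo a b, (Θx x - Θhx x) ^ 2 = A ^ 2 := (hsq wx).symm
  have hB2 : ∫ x in Ioo a b, (Θ x - Θh x) ^ 2 = B ^ 2 := (hsq w).symm
  have hZ2 : ∫ x in Ioo a b, (v x - vh x) ^ 2 = Z ^ 2 := (hsq z).symm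
  have hT2 : ∫ x in Ioo a b, Θx x ^ 2 = T ^ 2 := (hsq Θx).symm
  rw [hA2, hB2, hZ2, hT2]
  have hA0 : 0 ≤ A := Real.sqrt_nonneg _
  have hB0 : 0 ≤ B := Real.sqrt_nonneg _
  have hZ0 : 0 ≤ Z := Real.sqrt_nonneg _
  have hT0 : 0 ≤ T := Real.sqrt_nonneg _
  set S := √(B ^ 2 / L + 2 * (B * A)) with hS
  have hS0 : 0 ≤ S := Real.sqrt_nonneg _
  have hS2 : S ^ 2 = B ^ 2 / L + 2 * (B * A) := Real.sq_sqrt (by positivity)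
  have hwS : ∀ᵐ x ∂volume.restrict (Ioo a b), |w x| ≤ S := by
    filter_upwards [hGN] with x hx
    refine Real.abs_le_sqrt (hx.trans_eq ?_)
    rw [hB, hsq w]
  have hL1 : 0 ≤ ∫ x in Ioo a b, |Θ x| := integral_nonneg fun x => abs_nonneg _
  rw [nrmL2, nrmL1, ← Real.sqrt_eq_rpow] at hbound
  have hVK : √(∫ x in Ioo a b, vh x ^ 2) ≤ K := by linarith
  have hL1K : ∫ x in Ioo a b, |Θ x| ≤ K := by
    linarith [Real.sqrt_nonneg (∫ x in Ioo a b, vh x ^ 2)]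
  set R := K / L + √L * T with hR
  have hR0 : 0 ≤ R := by positivity
  have hΘR : ∀ᵐ x ∂volume.restrict (Ioo a b), |Θ x| ≤ R := by
    filter_upwards [hSob] with x hx
    refine hx.trans ?_
    rw [hR]
    gcongr
  have habsorb := hC A B Z T S hA0 hB0 hZ0 hT0 hS0 hS2
  have hfinal : ∀ X, X ≤ N * (A * Z + T * (A * Z) + S * (T * Z) + S * A + S ^ 2 * T) →
      X ≤ η * A ^ 2 + N * C * (1 + T ^ 2) * (Z ^ 2 + B ^ 2) := fun X hX => by
    refine hX.trans ((mul_le_mul_of_nonneg_left habsorb hN0.le).trans_eq ?_)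
    field_simp
  have hint : ∀ {g h : ℝ → ℝ}, MemL2 a b g → MemL2 a b h → ∀ c : ℝ,
      IntegrableOn (fun x => c * (|g x| * |h x|)) (Ioo a b) := fun hg hh c =>
    (hg.abs.integrableOn_mul hh.abs).const_mul c
  have hAZ : 0 ≤ A * Z := by positivity
  have hTAZ : 0 ≤ T * (A * Z) := by positivity
  have hSTZ : 0 ≤ S * (T * Z) := by positivity
  have hSA : 0 ≤ S * A := by positivity
  have hSST : 0 ≤ S ^ 2 * T := by positivity
  have hMK : 0 < M * K := by positivity
  have hMKL : 0 < M * (K / L) := by positivity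
  have hML : 0 < M * √L := by positivity
  have hwxz := hwxm.integral_abs_mul_abs_le hzm
  have hΘxz := hΘx.integral_abs_mul_abs_le hzm
  have hwxv := (hwxm.integral_abs_mul_abs_le hvh).trans (mul_le_mul_of_nonneg_left hVK hA0)
  have hΘxv := (hΘx.integral_abs_mul_abs_le hvh).trans (mul_le_mul_of_nonneg_left hVK hT0)
  constructor
  · have hI : |∫ x in Ioo a b, (f' (Θ x) * Θx x - f' (Θh x) * Θhx x) * z x| ≤
        ∫ x in Ioo a b, (M * (|wx x| * |z x|) + (M * S) * (|Θx x| * |z x|)) := by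
      refine abs_integral_le_of_ae_abs_le
        ((hint hwxm hzm M).add (hint hΘx hzm (M * S))) ?_
      filter_upwards [hΘ0, hΘh0, hwS] with x h0 hh0 hxS
      have e : (f' (Θ x) * Θx x - f' (Θh x) * Θhx x) * z x =
          f' (Θh x) * (wx x * z x) + (f' (Θ x) - f' (Θh x)) * (Θx x * z x) := by
        simp only [hwx]; ring
      rw [e, ← abs_mul, ← abs_mul]
      refine (abs_add_le _ _).trans ?_
      rw [abs_mul, abs_mul (f' (Θ x) - f' (Θh x))]
      have := (hf'Lip _ _ h0 hh0).trans (mul_le_mul_of_nonneg_left hxS hM0.le)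
      gcongr
      exact hf'M _ hh0
    rw [integral_add (hint hwxm hzm M) (hint hΘx hzm (M * S)), integral_const_mul,
      integral_const_mul] at hI
    refine hfinal _ ((neg_le_abs _).trans (hI.trans ?_))
    calc M * (∫ x in Ioo a b, |wx x| * |z x|) + M * S * (∫ x in Ioo a b, |Θx x| * |z x|)
        ≤ M * (A * Z) + M * S * (T * Z) := by gcongr
      _ = M * (A * Z) + M * (S * (T * Z)) := by ring
      _ ≤ N * (A * Z) + N * (S * (T * Z)) := by gcongr <;> linarith
      _ = N * (A * Z + S * (T * Z)) := by ring
      _ ≤ N * (A * Z + T * (A * Z) + S * (T * Z) + S * A + S ^ 2 * T) :=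
          mul_le_mul_of_nonneg_left (by linarith) hN0.le
  · have h12 : IntegrableOn (fun x => M * S * (|wx x| * |vh x|) + M * S ^ 2 * (|Θx x| * |vh x|))
        (Ioo a b) := (hint hwxm hvh (M * S)).add (hint hΘx hvh (M * S ^ 2))
    have hI : |∫ x in Ioo a b, (f' (Θ x) * Θx x * v x - f' (Θh x) * Θhx x * vh x) * w x| ≤
        ∫ x in Ioo a b, ((M * S) * (|wx x| * |vh x|) + (M * S ^ 2) * (|Θx x| * |vh x|) +
          (M * S) * (|Θx x| * |z x|)) := by
      refine abs_integral_le_of_ae_abs_le (h12.add (hint hΘx hzm (M * S))) ?_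
      filter_upwards [hΘ0, hΘh0, hwS] with x h0 hh0 hxS
      have e : (f' (Θ x) * Θx x * v x - f' (Θh x) * Θhx x * vh x) * w x =
          (f' (Θh x) * w x) * (wx x * vh x) +
            ((f' (Θ x) - f' (Θh x)) * w x) * (Θx x * vh x) +
            (f' (Θ x) * w x) * (Θx x * z x) := by
        simp only [hwx, hz]; ring
      rw [e, ← abs_mul, ← abs_mul, ← abs_mul]
      refine (abs_add_three _ _ _).trans ?_
      rw [abs_mul (f' (Θh x) * w x), abs_mul (f' (Θh x)), abs_mul ((f' (Θ x) - f' (Θh x)) * w x),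
        abs_mul (f' (Θ x) - f' (Θh x)), abs_mul (f' (Θ x) * w x), abs_mul (f' (Θ x))]
      have h1 := (hf'Lip _ _ h0 hh0).trans (mul_le_mul_of_nonneg_left hxS hM0.le)
      have h2 : |f' (Θ x) - f' (Θh x)| * |w x| ≤ M * S ^ 2 := by
        rw [sq, ← mul_assoc]
        gcongr
      gcongr
      · exact hf'M _ hh0
      · exact hf'M _ h0
    have hJ : |∫ x in Ioo a b, (f (Θ x) * v x - f (Θh x) * vh x) * wx x| ≤
        ∫ x in Ioo a b, ((M * R) * (|wx x| * |z x|) + (M * S) * (|wx x| * |vh x|)) := by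
      refine abs_integral_le_of_ae_abs_le
        ((hint hwxm hzm (M * R)).add (hint hwxm hvh (M * S))) ?_
      filter_upwards [hΘ0, hΘh0, hwS, hΘR] with x h0 hh0 hxS hxR
      have e : (f (Θ x) * v x - f (Θh x) * vh x) * wx x =
          f (Θ x) * (wx x * z x) + (f (Θ x) - f (Θh x)) * (wx x * vh x) := by
        simp only [hz]; ring
      rw [e, ← abs_mul, ← abs_mul]
      refine (abs_add_le _ _).trans ?_
      rw [abs_mul, abs_mul (f (Θ x) - f (Θh x))]
      have h1 := (hfLip _ _ h0 hh0).trans (mul_le_mul_of_nonneg_left hxS hM0.le)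
      have h2 := (hfM _ h0).trans (mul_le_mul_of_nonneg_left hxR hM0.le)
      gcongr
    rw [integral_add h12 (hint hΘx hzm (M * S)), integral_add (hint hwxm hvh (M * S)) (hint hΘx hvh (M * S ^ 2)),
      integral_const_mul, integral_const_mul, integral_const_mul] at hI
    rw [integral_add (hint hwxm hzm (M * R)) (hint hwxm hvh (M * S)), integral_const_mul,
      integral_const_mul] at hJ
    refine hfinal _ ((add_le_add ((le_abs_self _).trans hI) ((le_abs_self _).trans hJ)).trans ?_)
    calc M * S * (∫ x in Ioo a b, |wx x| * |vh x|) + M * S ^ 2 * (∫ x in Ioo a b, |Θx x| * |vh x|) +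
          M * S * (∫ x in Ioo a b, |Θx x| * |z x|) +
          (M * R * (∫ x in Ioo a b, |wx x| * |z x|) + M * S * (∫ x in Ioo a b, |wx x| * |vh x|))
        ≤ M * S * (A * K) + M * S ^ 2 * (T * K) + M * S * (T * Z) +
          (M * R * (A * Z) + M * S * (A * K)) := by gcongr
      _ = M * (K / L) * (A * Z) + M * √L * (T * (A * Z)) + M * (S * (T * Z)) +
          2 * (M * K) * (S * A) + M * K * (S ^ 2 * T) := by rw [hR]; ring
      _ ≤ N * (A * Z) + N * (T * (A * Z)) + N * (S * (T * Z)) + N * (S * A) +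
          N * (S ^ 2 * T) := by
          gcongr <;> linarith
      _ = N * (A * Z + T * (A * Z) + S * (T * Z) + S * A + S ^ 2 * T) := by ring
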